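/- For every N ≥ 1 there exists L_0 = L_0(N) with the following property. Let λ ∈ 𝔾𝕋_N be such that L := λ_N − λ_1 ≥ L_0, and let (μ^1 ≺ μ^2 ≺ … ≺ μ^N) be distributed according to the uniform measure on the finite set 𝔾𝕋^{(N)}_λ. Then for every real number c, Prob( |μ^1_1 − c| > L/(2·N!) ) ≥ 2^{−N−1}. -/

import Mathlib

/-- `μ ≺ lam`: interlacing, `lam_1 ≤ μ_1 ≤ lam_2 ≤ μ_2 ≤ … ≤ μ_n ≤ lam_{n+1}`. -/
def Interlaces {n : ℕ} (μ : Fin n → ℤ) (lam : Fin (n + 1) → ℤ) : Prop :=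
  ∀ i : Fin n, lam i.castSucc ≤ μ i ∧ μ i ≤ lam i.succ

/-- A half-strict Gelfand–Tsetlin pattern of depth `N`: rows `μ^1, …, μ^N` with `μ^k` a
strictly increasing `k`-tuple of integers, consecutive rows interlacing. -/
def IsGTPattern {N : ℕ} (μ : ∀ k : Fin N, Fin ((k : ℕ) + 1) → ℤ) : Prop :=
  (∀ k, StrictMono (μ k)) ∧
  ∀ k : Fin N, ∀ h : (k : ℕ) + 1 < N, Interlaces (μ k) (μ ⟨(k : ℕ) + 1, h⟩)

namespace GTArray

/-- Triangular arrays indexed by natural numbers (row `k` has entries `0, …, k`) satisfying the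
half-strict Gelfand–Tsetlin inequalities in the first `N` rows, and vanishing elsewhere. -/
structure IsPattern (N : ℕ) (e : ℕ → ℕ → ℤ) : Prop where
  support : ∀ k i, ¬ (k < N ∧ i ≤ k) → e k i = 0
  strict : ∀ k i, k < N → i < k → e k i < e k (i + 1)
  left : ∀ k i, k + 1 < N → i ≤ k → e (k + 1) i ≤ e k i
  right : ∀ k i, k + 1 < N → i ≤ k → e k i ≤ e (k + 1) (i + 1)

/-- Extension of a triangular array by zero. -/
def extend {N : ℕ} (μ : ∀ k : Fin N, Fin ((k : ℕ) + 1) → ℤ) (k i : ℕ) : ℤ :=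
  if h : k < N ∧ i < k + 1 then μ ⟨k, h.1⟩ ⟨i, h.2⟩ else 0

lemma extend_apply {N : ℕ} (μ : ∀ k : Fin N, Fin ((k : ℕ) + 1) → ℤ) {k i : ℕ}
    (hk : k < N) (hi : i < k + 1) : extend μ k i = μ ⟨k, hk⟩ ⟨i, hi⟩ := by
  simp only [extend, hk, hi, and_self, dite_true]

lemma extend_injective {N : ℕ} :
    Function.Injective (extend : (∀ k : Fin N, Fin ((k : ℕ) + 1) → ℤ) → ℕ → ℕ → ℤ) := by
  intro μ ν h
  funext k i
  have := congrFun (congrFun h k) i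
  rwa [extend_apply μ k.2 i.2, extend_apply ν k.2 i.2] at this

lemma extend_restrict {N : ℕ} {e : ℕ → ℕ → ℤ} (he : IsPattern N e) :
    extend (fun (k : Fin N) (i : Fin ((k : ℕ) + 1)) => e k i) = e := by
  funext k i
  unfold extend
  split_ifs with h
  · rfl
  · exact (he.support k i fun h' => h ⟨h'.1, by omega⟩).symm

lemma isPattern_extend_iff {N : ℕ} (μ : ∀ k : Fin N, Fin ((k : ℕ) + 1) → ℤ) :
    IsPattern N (extend μ) ↔ IsGTPattern μ := by
  constructor
  · intro h
    refine ⟨fun k => Fin.strictMono_iff_lt_succ.2 fun i => ?_, fun k hk i => ⟨?_, ?_⟩⟩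
    · have := h.strict k i k.2 i.2
      rwa [extend_apply μ k.2 (by omega), extend_apply μ k.2 (by omega)] at this
    · have := h.left k i hk (by omega)
      rwa [extend_apply μ k.2 i.2, extend_apply μ hk (by omega)] at this
    · have := h.right k i hk (by omega)
      rwa [extend_apply μ k.2 i.2, extend_apply μ hk (by omega)] at this
  · intro h
    refine ⟨fun k i hki => ?_, fun k i hk hi => ?_, fun k i hk hi => ?_, fun k i hk hi => ?_⟩
    · exact dif_neg fun h' => hki ⟨h'.1, by omega⟩
    · rw [extend_apply μ hk (by omega), extend_apply μ hk (by omega)]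
      exact h.1 ⟨k, hk⟩ (Fin.mk_lt_mk.2 (Nat.lt_succ_self i))
    · rw [extend_apply μ hk (by omega), extend_apply μ (by omega) (by omega)]
      exact (h.2 ⟨k, by omega⟩ hk ⟨i, Nat.lt_succ_of_le hi⟩).1
    · rw [extend_apply μ hk (by omega), extend_apply μ (by omega) (by omega)]
      exact (h.2 ⟨k, by omega⟩ hk ⟨i, Nat.lt_succ_of_le hi⟩).2

lemma card_eq_ncard {N : ℕ} (Q : (ℕ → ℕ → ℤ) → Prop) :
    Nat.card {μ : ∀ k : Fin N, Fin ((k : ℕ) + 1) → ℤ // IsGTPattern μ ∧ Q (extend μ)} =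
      {e | IsPattern N e ∧ Q e}.ncard := by
  have h : {e | IsPattern N e ∧ Q e} =
      extend '' {μ : ∀ k : Fin N, Fin ((k : ℕ) + 1) → ℤ | IsGTPattern μ ∧ Q (extend μ)} := by
    ext e
    constructor
    · rintro ⟨he, hQ⟩
      refine ⟨fun k i => e k i, ⟨(isPattern_extend_iff _).1 ?_, ?_⟩, extend_restrict he⟩
      · rwa [extend_restrict he]
      · rwa [extend_restrict he]
    · rintro ⟨μ, ⟨hμ, hQ⟩, rfl⟩
      exact ⟨(isPattern_extend_iff _).2 hμ, hQ⟩
  rw [h, Set.ncard_image_of_injective _ extend_injective]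
  rfl

namespace IsPattern

variable {N : ℕ} {e : ℕ → ℕ → ℤ}

lemma mono (he : IsPattern N e) {k i j : ℕ} (hk : k < N) (hij : i ≤ j) (hj : j ≤ k) :
    e k i ≤ e k j := by
  induction j, hij using Nat.le_induction with
  | base => exact le_rfl
  | succ j hij ih => exact (ih (by omega)).trans (he.strict k j hk (by omega)).le

lemma mem_Icc {n : ℕ} (he : IsPattern (n + 1) e) (d : ℕ) :
    ∀ k i, k + d = n → i ≤ k → e n 0 ≤ e k i ∧ e k i ≤ e n n := by
  induction d with
  | zero =>
    rintro k i rfl hi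
    exact ⟨he.mono (by omega) (by omega) hi, he.mono (by omega) hi le_rfl⟩
  | succ d ih =>
    intro k i hk hi
    exact ⟨(ih (k + 1) i (by omega) (by omega)).1.trans (he.left k i (by omega) hi),
      (he.right k i (by omega) hi).trans (ih (k + 1) (i + 1) (by omega) (by omega)).2⟩

end IsPattern

/-- The patterns of depth `n + 1` with top row `ν`. -/
def patterns (n : ℕ) (ν : ℕ → ℤ) : Set (ℕ → ℕ → ℤ) :=
  {e | IsPattern (n + 1) e ∧ ∀ b ≤ n, e n b = ν b}

lemma patterns_finite (n : ℕ) (ν : ℕ → ℤ) : (patterns n ν).Finite := by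
  have hfin : (Set.Icc (fun _ _ => ν 0) (fun _ _ => ν n) :
      Set (∀ k : Fin (n + 1), Fin ((k : ℕ) + 1) → ℤ)).Finite := Set.finite_Icc _ _
  refine (hfin.image extend).subset fun e he => ⟨fun k i => e k i, ?_, extend_restrict he.1⟩
  have h : ∀ (k : Fin (n + 1)) (i : Fin ((k : ℕ) + 1)), ν 0 ≤ e k i ∧ e k i ≤ ν n := by
    intro k i
    rw [← he.2 0 (by omega), ← he.2 n le_rfl]
    exact he.1.mem_Icc (n - k) k i (by omega) (by omega)
  exact ⟨fun k i => (h k i).1, fun k i => (h k i).2⟩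

/-- The largest value allowed for the first entry of row `r` by the neighbouring entries. -/
def firstMax (r : ℕ) (e : ℕ → ℕ → ℤ) : ℤ :=
  min (min (e (r + 1) 1) (e (r - 1) 0)) (if 2 ≤ r then e r 1 - 1 else e (r + 1) 1)

/-- The smallest value allowed for the last entry of row `r` by the neighbouring entries. -/
def lastMin (r : ℕ) (e : ℕ → ℕ → ℤ) : ℤ :=
  max (max (e (r + 1) r) (e (r - 1) (r - 1))) (if 2 ≤ r then e r (r - 1) + 1 else e (r + 1) r)

/-- Reflect the first and the last entry of row `r` in the intervals available to them. -/
def reflect (r : ℕ) (e : ℕ → ℕ → ℤ) (k i : ℕ) : ℤ :=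
  if k = r ∧ i = 0 then e (r + 1) 0 + firstMax r e - e r 0
  else if k = r ∧ i = r then lastMin r e + e (r + 1) (r + 1) - e r r
  else e k i

lemma reflect_first (r : ℕ) (e : ℕ → ℕ → ℤ) :
    reflect r e r 0 = e (r + 1) 0 + firstMax r e - e r 0 := by
  simp [reflect]

lemma reflect_last {r : ℕ} (hr : 1 ≤ r) (e : ℕ → ℕ → ℤ) :
    reflect r e r r = lastMin r e + e (r + 1) (r + 1) - e r r := by
  simp [reflect, show r ≠ 0 by omega]

lemma reflect_of_ne {r k i : ℕ} (e : ℕ → ℕ → ℤ) (h : k ≠ r ∨ (i ≠ 0 ∧ i ≠ r)) :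
    reflect r e k i = e k i := by
  rw [reflect, if_neg (by omega), if_neg (by omega)]

lemma firstMax_reflect {r : ℕ} (hr : 1 ≤ r) (e : ℕ → ℕ → ℤ) :
    firstMax r (reflect r e) = firstMax r e := by
  unfold firstMax
  rw [reflect_of_ne e (k := r + 1) (by omega), reflect_of_ne e (k := r - 1) (by omega)]
  split_ifs with h
  · rw [reflect_of_ne e (k := r) (by omega)]
  · rfl

lemma lastMin_reflect {r : ℕ} (hr : 1 ≤ r) (e : ℕ → ℕ → ℤ) :
    lastMin r (reflect r e) = lastMin r e := by
  unfold lastMin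
  rw [reflect_of_ne e (k := r + 1) (by omega), reflect_of_ne e (k := r - 1) (by omega)]
  split_ifs with h
  · rw [reflect_of_ne e (k := r) (by omega)]
  · rfl

lemma reflect_involutive {r : ℕ} (hr : 1 ≤ r) : Function.Involutive (reflect r) := by
  intro e
  funext k i
  by_cases h0 : k = r ∧ i = 0
  · obtain ⟨rfl, rfl⟩ := h0
    rw [reflect_first, firstMax_reflect hr, reflect_first, reflect_of_ne e (by omega)]
    ring
  by_cases h1 : k = r ∧ i = r
  · obtain ⟨rfl, rfl⟩ := h1
    rw [reflect_last hr, lastMin_reflect hr, reflect_last hr, reflect_of_ne e (by omega)]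
    ring
  rw [reflect_of_ne _ (by omega), reflect_of_ne _ (by omega)]

namespace IsPattern

variable {N r : ℕ} {e : ℕ → ℕ → ℤ}

lemma first_le_firstMax (he : IsPattern N e) (hr : 1 ≤ r) (hN : r + 1 < N) :
    e r 0 ≤ firstMax r e := by
  have h1 := he.right r 0 hN (by omega)
  have h2 := he.left (r - 1) 0 (by omega) (by omega)
  have h3 := he.strict r 0 (by omega) (by omega)
  rw [Nat.sub_add_cancel hr] at h2
  simp only [zero_add] at h1 h3
  unfold firstMax
  split_ifs <;> omega

lemma lastMin_le_last (he : IsPattern N e) (hr : 1 ≤ r) (hN : r + 1 < N) :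
    lastMin r e ≤ e r r := by
  have h1 := he.left r r hN le_rfl
  have h2 := he.right (r - 1) (r - 1) (by omega) le_rfl
  have h3 := he.strict r (r - 1) (by omega) (by omega)
  rw [Nat.sub_add_cancel hr] at h2 h3
  unfold lastMin
  split_ifs <;> omega

lemma firstMax_le_lastMin (he : IsPattern N e) (hN : r + 1 < N) :
    firstMax r e ≤ lastMin r e := by
  have h := he.mono (k := r - 1) (by omega) (Nat.zero_le (r - 1)) le_rfl
  unfold firstMax lastMin
  omega

lemma le_reflect_spread (he : IsPattern N e) (hr : 1 ≤ r) (hN : r + 1 < N) :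
    (e (r + 1) (r + 1) - e (r + 1) 0) - (e r r - e r 0) ≤
      reflect r e r r - reflect r e r 0 := by
  rw [reflect_first, reflect_last hr]
  have := he.firstMax_le_lastMin hN
  omega

/-- Reflection keeps the pattern inequalities as soon as it leaves row `r` nonconstant. -/
lemma reflect (he : IsPattern N e) (hr : 1 ≤ r) (hN : r + 1 < N)
    (hlt : reflect r e r 0 < reflect r e r r) : IsPattern N (reflect r e) := by
  have a1 := he.first_le_firstMax hr hN
  have a2 := he.lastMin_le_last hr hN
  have a3 := he.left r 0 hN (by omega)
  have a4 := he.right r r hN le_rfl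
  have hf := reflect_first r e
  have hl := reflect_last hr e
  have b1 : GTArray.reflect r e r 0 ≤ firstMax r e := by omega
  have b2 : lastMin r e ≤ GTArray.reflect r e r r := by omega
  have b3 : e (r + 1) 0 ≤ GTArray.reflect r e r 0 := by omega
  have b4 : GTArray.reflect r e r r ≤ e (r + 1) (r + 1) := by omega
  have c1 : firstMax r e ≤ e (r + 1) 1 := (min_le_left _ _).trans (min_le_left _ _)
  have c2 : firstMax r e ≤ e (r - 1) 0 := (min_le_left _ _).trans (min_le_right _ _)
  have c3 : e (r + 1) r ≤ lastMin r e := (le_max_left _ _).trans (le_max_left _ _)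
  have c4 : e (r - 1) (r - 1) ≤ lastMin r e := (le_max_right _ _).trans (le_max_left _ _)
  have c5 : 2 ≤ r → firstMax r e < e r 1 := fun h => by
    have : firstMax r e ≤ _ := min_le_right _ _
    rw [if_pos h] at this
    omega
  have c6 : 2 ≤ r → e r (r - 1) < lastMin r e := fun h => by
    have : _ ≤ lastMin r e := le_max_right _ _
    rw [if_pos h] at this
    omega
  refine ⟨fun k i hki => ?_, fun k i hk hi => ?_, fun k i hk hi => ?_, fun k i hk hi => ?_⟩
  · rw [reflect_of_ne e (by omega)]
    exact he.support k i hki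
  · by_cases hkr : k = r
    · subst hkr
      rcases Nat.eq_zero_or_pos i with rfl | hi0
      · rcases Nat.lt_or_ge 1 k with h | h
        · rw [reflect_of_ne e (i := 0 + 1) (by omega)]
          exact b1.trans_lt (c5 h)
        · obtain rfl : k = 1 := by omega
          exact hlt
      · rw [reflect_of_ne e (i := i) (by omega)]
        by_cases hik : i + 1 = k
        · rw [hik]
          have := c6 (by omega)
          rw [← hik, Nat.add_sub_cancel, hik] at this
          exact this.trans_le b2
        · rw [reflect_of_ne e (by omega)]
          exact he.strict k i hk hi
    · rw [reflect_of_ne e (by omega), reflect_of_ne e (by omega)]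
      exact he.strict k i hk hi
  · by_cases hkr : k = r
    · subst hkr
      rw [reflect_of_ne e (k := k + 1) (by omega)]
      rcases Nat.eq_zero_or_pos i with rfl | hi0
      · exact b3
      · rcases hi.eq_or_lt with rfl | hik
        · exact c3.trans b2
        · rw [reflect_of_ne e (by omega)]
          exact he.left k i hk hi
    · rw [reflect_of_ne e (k := k) (by omega)]
      by_cases hi0 : k + 1 = r ∧ i = 0
      · obtain ⟨rfl, rfl⟩ := hi0
        exact b1.trans c2
      · rw [reflect_of_ne e (by omega)]
        exact he.left k i hk hi
  · by_cases hkr : k = r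
    · subst hkr
      rw [reflect_of_ne e (k := k + 1) (by omega)]
      rcases Nat.eq_zero_or_pos i with rfl | hi0
      · exact b1.trans c1
      · rcases hi.eq_or_lt with rfl | hik
        · exact b4
        · rw [reflect_of_ne e (by omega)]
          exact he.right k i hk hi
    · rw [reflect_of_ne e (k := k) (by omega)]
      by_cases hi0 : k + 1 = r ∧ i = k
      · obtain ⟨rfl, rfl⟩ := hi0
        exact c4.trans b2
      · rw [reflect_of_ne e (by omega)]
        exact he.right k i hk hi

end IsPattern

/-- The patterns in which row `r` has spread at least `s`. -/
def wide (n : ℕ) (ν : ℕ → ℤ) (r : ℕ) (s : ℝ) : Set (ℕ → ℕ → ℤ) :=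
  {e ∈ patterns n ν | s ≤ ((e r r - e r 0 : ℤ) : ℝ)}

lemma wide_finite (n : ℕ) (ν : ℕ → ℤ) (r : ℕ) (s : ℝ) : (wide n ν r s).Finite :=
  (patterns_finite n ν).subset fun _ he => he.1

lemma ncard_le_two_mul {α : Type*} {A B : Set α} (hB : B.Finite) (f : α → α)
    (hf : Function.Injective f) (h : ∀ x ∈ A, x ∉ B → f x ∈ B) : A.ncard ≤ 2 * B.ncard := by
  have h1 : (A \ B).ncard ≤ B.ncard :=
    Set.ncard_le_ncard_of_injOn f (fun x hx => h x hx.1 hx.2) hf.injOn hB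
  have h2 := Set.ncard_le_ncard_sdiff_add_ncard A B hB
  omega

lemma ncard_wide_le {n r : ℕ} (ν : ℕ → ℤ) {s : ℝ} (hs : 0 < s) (hr : 1 ≤ r) (hn : r < n) :
    (wide n ν (r + 1) (2 * s)).ncard ≤ 2 * (wide n ν r s).ncard := by
  refine ncard_le_two_mul (wide_finite ..) _ (reflect_involutive hr).injective ?_
  rintro e ⟨he, hw⟩ hnw
  have hlt : ((e r r - e r 0 : ℤ) : ℝ) < s := not_le.1 fun h => hnw ⟨he, h⟩
  have hle : ((_ : ℤ) : ℝ) ≤ ((_ : ℤ) : ℝ) :=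
    Int.cast_le.2 (he.1.le_reflect_spread hr (by omega))
  have hspread : s ≤ ((reflect r e r r - reflect r e r 0 : ℤ) : ℝ) := by
    rw [Int.cast_sub (_ - _)] at hle
    linarith
  have hpos : 0 < reflect r e r r - reflect r e r 0 := by exact_mod_cast hs.trans_le hspread
  refine ⟨⟨he.1.reflect hr (by omega) (by omega), fun b hb => ?_⟩, hspread⟩
  rw [reflect_of_ne e (by omega)]
  exact he.2 b hb

lemma ncard_patterns_le_wide {n : ℕ} (ν : ℕ → ℤ) (hν : ν 0 < ν n) (d : ℕ) :
    ∀ r, 1 ≤ r → r + d = n →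
      (patterns n ν).ncard ≤ 2 ^ d * (wide n ν r (((ν n - ν 0 : ℤ) : ℝ) / 2 ^ d)).ncard := by
  have hpos : (0 : ℝ) < ((ν n - ν 0 : ℤ) : ℝ) := by exact_mod_cast sub_pos.2 hν
  induction d with
  | zero =>
    rintro r - rfl
    rw [pow_zero, one_mul]
    refine Set.ncard_le_ncard (fun e he => ⟨he, ?_⟩) (wide_finite ..)
    have h0 := he.2 0 (by omega)
    have h1 := he.2 (r + 0) le_rfl
    simp only [Nat.add_zero] at h0 h1 ⊢
    rw [pow_zero, div_one, h0, h1]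
  | succ d ih =>
    intro r hr hn
    have h1 := ih (r + 1) (by omega) (by omega)
    have h2 := ncard_wide_le (n := n) (r := r) ν
      (s := ((ν n - ν 0 : ℤ) : ℝ) / 2 ^ (d + 1)) (by positivity) hr (by omega)
    rw [show 2 * (((ν n - ν 0 : ℤ) : ℝ) / 2 ^ (d + 1)) = ((ν n - ν 0 : ℤ) : ℝ) / 2 ^ d by
      rw [pow_succ]; field_simp] at h2
    calc _ ≤ _ := h1
      _ ≤ 2 ^ d * (2 * _) := Nat.mul_le_mul_left _ h2
      _ = _ := by rw [← mul_assoc, ← pow_succ]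

/-- Replace the entry of row `0`. -/
def setApex (y : ℤ) (e : ℕ → ℕ → ℤ) (k i : ℕ) : ℤ :=
  if k = 0 ∧ i = 0 then y else e k i

lemma setApex_of_ne {k i : ℕ} (y : ℤ) (e : ℕ → ℕ → ℤ) (h : k ≠ 0 ∨ i ≠ 0) :
    setApex y e k i = e k i := if_neg (by omega)

lemma IsPattern.setApex {N : ℕ} {e : ℕ → ℕ → ℤ} (he : IsPattern N e) (hN : 0 < N) {y : ℤ}
    (h0 : e 1 0 ≤ y) (h1 : y ≤ e 1 1) : IsPattern N (setApex y e) := by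
  refine ⟨fun k i hki => ?_, fun k i hk hi => ?_, fun k i hk hi => ?_, fun k i hk hi => ?_⟩
  · rw [setApex_of_ne _ _ (by omega)]
    exact he.support k i hki
  · rw [setApex_of_ne _ _ (by omega), setApex_of_ne _ _ (by omega)]
    exact he.strict k i hk hi
  · rw [setApex_of_ne (k := k + 1) _ _ (by omega)]
    by_cases h : k = 0 ∧ i = 0
    · obtain ⟨rfl, rfl⟩ := h
      exact h0
    · rw [setApex_of_ne _ _ (by omega)]
      exact he.left k i hk hi
  · rw [setApex_of_ne (k := k + 1) _ _ (by omega)]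
    by_cases h : k = 0 ∧ i = 0
    · obtain ⟨rfl, rfl⟩ := h
      exact h1
    · rw [setApex_of_ne _ _ (by omega)]
      exact he.right k i hk hi

/-- A new value for the entry of row `0`, chosen near the end of its range that is further away
from `c`; it determines the old value `e 0 0` up to the residue of `e 0 0 - m` modulo `3`. -/
noncomputable def farApex (c : ℝ) (m : ℤ) (e : ℕ → ℕ → ℤ) : ℤ :=
  open Classical in
  if (e 1 0 : ℝ) + e 1 1 ≥ 2 * c then e 1 1 - (e 0 0 - m) / 3 else e 1 0 + (e 0 0 - m) / 3

lemma farApex_injective {c : ℝ} {m : ℤ} {e e' : ℕ → ℕ → ℤ}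
    (h : setApex (farApex c m e) e = setApex (farApex c m e') e')
    (h3 : (e 0 0 - m) % 3 = (e' 0 0 - m) % 3) : e = e' := by
  have hne : ∀ k i, k ≠ 0 ∨ i ≠ 0 → e k i = e' k i := fun k i hki => by
    have := congrFun (congrFun h k) i
    rwa [setApex_of_ne _ _ hki, setApex_of_ne _ _ hki] at this
  have h0 : farApex c m e = farApex c m e' := congrFun (congrFun h 0) 0
  have h00 : e 0 0 = e' 0 0 := by
    unfold farApex at h0
    rw [hne 1 0 (by omega), hne 1 1 (by omega)] at h0
    split_ifs at h0 <;> omega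
  funext k i
  by_cases hki : k = 0 ∧ i = 0
  · rw [hki.1, hki.2, h00]
  · exact hne k i (by omega)

/-- The patterns whose apex is at distance more than `ρ` from `c`. -/
def far (n : ℕ) (ν : ℕ → ℤ) (c ρ : ℝ) : Set (ℕ → ℕ → ℤ) :=
  {e ∈ patterns n ν | |(e 0 0 : ℝ) - c| > ρ}

lemma setApex_mem_far {n : ℕ} {ν : ℕ → ℤ} (hn : 1 ≤ n) {c ρ s : ℝ} (hρ : 0 < ρ)
    (hs : 4 * ρ ≤ s) {e : ℕ → ℕ → ℤ} (he : e ∈ wide n ν 1 s) (hnear : |(e 0 0 : ℝ) - c| ≤ ρ) :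
    setApex (farApex c ⌈c - ρ⌉ e) e ∈ far n ν c ρ := by
  obtain ⟨⟨he, htop⟩, hw⟩ := he
  rw [abs_le] at hnear
  have hx0 := he.left 0 0 (by omega) le_rfl
  have hx1 := he.right 0 0 (by omega) le_rfl
  simp only [zero_add] at hx0 hx1
  set x := e 0 0 with hx
  set m := ⌈c - ρ⌉ with hm
  have hmx : m ≤ x := Int.ceil_le.2 (by linarith)
  have hmc : c - ρ ≤ m := Int.le_ceil _
  set t := (x - m) / 3 with ht
  have ht0 : 0 ≤ t := by omega
  have ht3 : 3 * (t : ℝ) ≤ 2 * ρ := by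
    have : (3 : ℝ) * t ≤ x - m := by exact_mod_cast (show 3 * t ≤ x - m by omega)
    linarith
  have ht0' : (0 : ℝ) ≤ t := by exact_mod_cast ht0
  push_cast at hw
  have hx0' : (e 1 0 : ℝ) ≤ x := by exact_mod_cast hx0
  have hx1' : (x : ℝ) ≤ e 1 1 := by exact_mod_cast hx1
  obtain ⟨y, hy⟩ : ∃ y, y = farApex c m e := ⟨_, rfl⟩
  have key : e 1 0 ≤ y ∧ y ≤ e 1 1 ∧ |(y : ℝ) - c| > ρ := by
    unfold farApex at hy
    rw [← hx, ← ht] at hy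
    split_ifs at hy with hc
    · have h : c + ρ < y := by rw [hy]; push_cast; linarith
      refine ⟨?_, by omega, lt_abs.2 (Or.inl (by linarith))⟩
      exact_mod_cast (show (e 1 0 : ℝ) ≤ y by linarith)
    · have h : (y : ℝ) < c - ρ := by rw [hy]; push_cast; linarith
      refine ⟨by omega, ?_, lt_abs.2 (Or.inr (by linarith))⟩
      exact_mod_cast (show (y : ℝ) ≤ e 1 1 by linarith)
  rw [← hy]
  refine ⟨⟨he.setApex (by omega) key.1 key.2.1, fun b hb => ?_⟩, key.2.2⟩
  rw [setApex_of_ne _ _ (by omega)]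
  exact htop b hb

lemma ncard_wide_le_far {n : ℕ} {ν : ℕ → ℤ} (hn : 1 ≤ n) (c : ℝ) {ρ s : ℝ} (hρ : 0 < ρ)
    (hs : 4 * ρ ≤ s) : (wide n ν 1 s).ncard ≤ 4 * (far n ν c ρ).ncard := by
  have hfin : (far n ν c ρ).Finite := (patterns_finite n ν).subset fun _ he => he.1
  have h1 : (wide n ν 1 s \ far n ν c ρ).ncard ≤
      (far n ν c ρ ×ˢ (Set.Ico 0 3 : Set ℤ)).ncard := by
    refine Set.ncard_le_ncard_of_injOn
      (fun e => (setApex (farApex c ⌈c - ρ⌉ e) e, (e 0 0 - ⌈c - ρ⌉) % 3)) ?_ ?_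
      (hfin.prod (Set.finite_Ico _ _))
    · rintro e ⟨he, hfar⟩
      exact ⟨setApex_mem_far hn hρ hs he (not_lt.1 fun h => hfar ⟨he.1, h⟩),
        Int.emod_nonneg _ (by omega), Int.emod_lt_of_pos _ (by omega)⟩
    · intro e _ e' _ h
      exact farApex_injective (Prod.ext_iff.1 h).1 (Prod.ext_iff.1 h).2
  have h2 := Set.ncard_le_ncard_sdiff_add_ncard (wide n ν 1 s) (far n ν c ρ) hfin
  have h3 : (Set.Ico 0 3 : Set ℤ).ncard = 3 := by
    rw [← Finset.coe_Ico, Set.ncard_coe_finset]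
    rfl
  rw [Set.ncard_prod, h3] at h1
  omega

theorem ncard_patterns_le_far (n : ℕ) (ν : ℕ → ℤ) (hν : ν 0 < ν (n + 1)) (c : ℝ) :
    (patterns (n + 1) ν).ncard ≤ 2 ^ (n + 2) *
      (far (n + 1) ν c (((ν (n + 1) - ν 0 : ℤ) : ℝ) / (2 * ((n + 2).factorial : ℝ)))).ncard := by
  have hpos : (0 : ℝ) < ((ν (n + 1) - ν 0 : ℤ) : ℝ) := by exact_mod_cast sub_pos.2 hν
  have h1 := ncard_patterns_le_wide ν hν n 1 le_rfl (by omega)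
  have hfact : (2 : ℝ) ^ (n + 1) ≤ ((n + 2).factorial : ℝ) := by
    have := Nat.factorial_mul_pow_le_factorial (m := 1) (n := n + 1)
    rw [Nat.factorial_one, one_mul, Nat.add_comm 1 (n + 1)] at this
    exact_mod_cast this
  have h2 := ncard_wide_le_far (n := n + 1) (ν := ν) (by omega) c
    (ρ := ((ν (n + 1) - ν 0 : ℤ) : ℝ) / (2 * ((n + 2).factorial : ℝ)))
    (s := ((ν (n + 1) - ν 0 : ℤ) : ℝ) / 2 ^ n) (by positivity) (by
      rw [mul_div_assoc', div_le_div_iff₀ (by positivity) (by positivity)]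
      rw [pow_succ] at hfact
      nlinarith)
  calc _ ≤ _ := h1
    _ ≤ 2 ^ n * (4 * _) := Nat.mul_le_mul_left _ h2
    _ = _ := by rw [pow_add]; ring

end GTArray

open GTArray in
/-- For every `N ≥ 1` there is `L₀ = L₀(N)` such that: if `λ ∈ 𝔾𝕋_N` has
`L := λ_N − λ_1 ≥ L₀` and `(μ^1 ≺ … ≺ μ^N)` is uniform on `𝔾𝕋^{(N)}_λ`, then for every real
`c`, `Prob(|μ^1_1 − c| > L/(2·N!)) ≥ 2^{−N−1}` (probabilities written as counting ratios). -/
theorem gt_polytope_spread (N : ℕ) (hN : 1 ≤ N) :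
    ∃ L₀ : ℤ, ∀ lam : Fin N → ℤ, StrictMono lam →
      L₀ ≤ lam ⟨N - 1, by omega⟩ - lam ⟨0, by omega⟩ →
      ∀ c : ℝ,
        (Nat.card {μ : ∀ i : Fin N, Fin ((i : ℕ) + 1) → ℤ //
            IsGTPattern μ ∧
            (∀ b : Fin (N - 1 + 1), μ ⟨N - 1, by omega⟩ b = lam ⟨(b : ℕ), by omega⟩) ∧
            |((μ ⟨0, by omega⟩ ⟨0, by omega⟩ : ℤ) : ℝ) - c| >
              (((lam ⟨N - 1, by omega⟩ - lam ⟨0, by omega⟩ : ℤ) : ℝ)) /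
                (2 * (Nat.factorial N : ℝ))} : ℝ) ≥
        ((2 : ℝ) ^ (N + 1))⁻¹ *
          (Nat.card {μ : ∀ i : Fin N, Fin ((i : ℕ) + 1) → ℤ //
            IsGTPattern μ ∧
            (∀ b : Fin (N - 1 + 1), μ ⟨N - 1, by omega⟩ b = lam ⟨(b : ℕ), by omega⟩)} : ℝ) := by
  refine ⟨1, fun lam _ hL c => ?_⟩
  obtain _ | _ | n := N
  · omega
  · simp at hL
  set ν : ℕ → ℤ := fun b => if h : b < n + 2 then lam ⟨b, h⟩ else 0 with hν
  have hνb : ∀ b (h : b < n + 2), ν b = lam ⟨b, h⟩ := fun b h => dif_pos h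
  have htop : ∀ μ : ∀ i : Fin (n + 2), Fin ((i : ℕ) + 1) → ℤ,
      (∀ b : Fin (n + 2 - 1 + 1), μ ⟨n + 2 - 1, by omega⟩ b = lam ⟨(b : ℕ), by omega⟩) ↔
        ∀ b ≤ n + 1, extend μ (n + 1) b = ν b := by
    intro μ
    constructor
    · intro h b hb
      rw [extend_apply μ (by omega) (by omega), hνb b (by omega)]
      exact h ⟨b, by omega⟩
    · intro h b
      have := h b (by omega)
      rwa [extend_apply μ (by omega) (by omega), hνb b (by omega)] at this
  have hall := card_eq_ncard (N := n + 2) (fun e => ∀ b ≤ n + 1, e (n + 1) b = ν b)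
  have hfar := card_eq_ncard (N := n + 2) (fun e => (∀ b ≤ n + 1, e (n + 1) b = ν b) ∧
    |(e 0 0 : ℝ) - c| > ((ν (n + 1) - ν 0 : ℤ) : ℝ) / (2 * ((n + 2).factorial : ℝ)))
  have hset : {e | IsPattern (n + 2) e ∧ (∀ b ≤ n + 1, e (n + 1) b = ν b) ∧
      |(e 0 0 : ℝ) - c| > ((ν (n + 1) - ν 0 : ℤ) : ℝ) / (2 * ((n + 2).factorial : ℝ))} =
      far (n + 1) ν c (((ν (n + 1) - ν 0 : ℤ) : ℝ) / (2 * ((n + 2).factorial : ℝ))) := by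
    ext e
    exact and_assoc.symm
  have hlt : ν 0 < ν (n + 1) := by
    rw [hνb 0 (by omega), hνb (n + 1) (by omega)]
    have : 1 ≤ lam ⟨n + 1, by omega⟩ - lam ⟨0, by omega⟩ := hL
    omega
  have main := ncard_patterns_le_far n ν hlt c
  rw [← hset, ← hfar, show patterns (n + 1) ν =
    {e | IsPattern (n + 2) e ∧ ∀ b ≤ n + 1, e (n + 1) b = ν b} from rfl, ← hall] at main
  simp only [← htop] at main
  rw [hνb 0 (by omega), hνb (n + 1) (by omega)] at main
  simp only [extend_apply _ (show 0 < n + 2 by omega) (show 0 < 0 + 1 by omega)] at main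
  rw [ge_iff_le, inv_mul_le_iff₀ (by positivity)]
  refine (Nat.cast_le (α := ℝ).2 main).trans ?_
  push_cast
  refine mul_le_mul_of_nonneg_right ?_ (Nat.cast_nonneg _)
  exact pow_le_pow_right₀ (by norm_num) (by omega)
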